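/- Let φ be a circle covering map of degree two, not topologically conjugate to the doubling map, such that the collection of all maximal periodic intervals of φ is finite and nonempty, say I₁,…,I_r, and set Λ := 𝕊¹ \ ⋃_{n≥0} φ^{-n}(I₁ ∪ ⋯ ∪ I_r). Let x be a periodic point of φ of period s. If there exists ε > 0 such that (x, x+ε) ∩ Λ = ∅, then x is the left endpoint of a periodic interval of φ of period s. Symmetrically, if there exists ε > 0 such that (x−ε, x) ∩ Λ = ∅, then x is the right endpoint of a periodic interval of φ of period s. -/

import Mathlib

open Set Filter MeasureTheory Topology

noncomputable section

/-- `F : ℝ → ℝ` is a lift of `φ : 𝕊¹ → 𝕊¹` witnessing that `φ` is a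
circle covering map of degree two. -/
def IsLiftDeg2 (φ : UnitAddCircle → UnitAddCircle) (F : ℝ → ℝ) : Prop :=
  Continuous F ∧ StrictMono F ∧ (∀ x : ℝ, F (x + 1) = F x + 2) ∧
    ∀ x : ℝ, φ (x : UnitAddCircle) = ((F x : ℝ) : UnitAddCircle)

/-- The closed arc on the circle starting at `a` (counterclockwise) of length `ℓ`. -/
def closedArc (a ℓ : ℝ) : Set UnitAddCircle :=
  (fun t : ℝ => (t : UnitAddCircle)) '' Set.Icc a (a + ℓ)

/-- The open arc on the circle starting at `a` (counterclockwise) of length `ℓ`. -/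
def openArc (a ℓ : ℝ) : Set UnitAddCircle :=
  (fun t : ℝ => (t : UnitAddCircle)) '' Set.Ioo a (a + ℓ)

/-- The open arc `(x, x + ε)` counterclockwise. -/
def rightArc (x : UnitAddCircle) (ε : ℝ) : Set UnitAddCircle :=
  {y | ∃ t : ℝ, 0 < t ∧ t < ε ∧ y = x + (t : UnitAddCircle)}

/-- The open arc `(x - ε, x)` counterclockwise. -/
def leftArc (x : UnitAddCircle) (ε : ℝ) : Set UnitAddCircle :=
  {y | ∃ t : ℝ, 0 < t ∧ t < ε ∧ y = x - (t : UnitAddCircle)}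

/-- `I` is a periodic interval of `φ` of period `s`: a proper nondegenerate closed arc
mapped onto itself homeomorphically by `φ^s`. -/
def IsPeriodicInterval (φ : UnitAddCircle → UnitAddCircle) (s : ℕ)
    (I : Set UnitAddCircle) : Prop :=
  1 ≤ s ∧ (∃ a ℓ : ℝ, 0 < ℓ ∧ ℓ < 1 ∧ I = closedArc a ℓ) ∧ Set.BijOn (φ^[s]) I I

/-- A maximal periodic interval of `φ`. -/
def IsMaxPeriodicInterval (φ : UnitAddCircle → UnitAddCircle)
    (I : Set UnitAddCircle) : Prop :=
  (∃ s, IsPeriodicInterval φ s I) ∧ ∀ J, (∃ s, IsPeriodicInterval φ s J) → I ⊆ J → I = J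

/-- `Λ = 𝕊¹ \ ⋃ₙ φ⁻ⁿ(I₁ ∪ ⋯ ∪ I_r)`, the complement of all preimages of the
maximal periodic intervals. -/
def lambdaSet (φ : UnitAddCircle → UnitAddCircle) : Set UnitAddCircle :=
  Set.univ \ ⋃ n : ℕ, (φ^[n]) ⁻¹' (⋃ I ∈ {I | IsMaxPeriodicInterval φ I}, I)

/-- The doubling map `x ↦ 2x (mod 1)`. -/
def doubling : UnitAddCircle → UnitAddCircle := fun x => x + x

/-- `φ` is topologically conjugate to the doubling map. -/
def ConjugateToDoubling (φ : UnitAddCircle → UnitAddCircle) : Prop :=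
  ∃ h : UnitAddCircle ≃ₜ UnitAddCircle, ∀ x, h (φ x) = doubling (h x)

/-- `I` is a `φ`-dyadic interval of degree `n` (described via the lift `F` of `φ`):
a closed arc whose endpoints are consecutive `φⁿ`-preimages of `0`. -/
def IsDyadic (F : ℝ → ℝ) (n : ℕ) (I : Set UnitAddCircle) : Prop :=
  ∃ a b : ℝ, a < b ∧ (∃ k : ℤ, F^[n] a = (k : ℝ)) ∧ F^[n] b = F^[n] a + 1 ∧
    I = (fun t : ℝ => (t : UnitAddCircle)) '' Set.Icc a b

/-- `G` is a lift of the orientation-preserving circle homeomorphism `g`. -/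
def IsOPLift (g : UnitAddCircle → UnitAddCircle) (G : ℝ → ℝ) : Prop :=
  Continuous G ∧ StrictMono G ∧ (∀ x : ℝ, G (x + 1) = G x + 1) ∧
    ∀ x : ℝ, g (x : UnitAddCircle) = ((G x : ℝ) : UnitAddCircle)

/-- `g` belongs to the Ghys–Sergiescu Thompson group `T_φ` (with `F` a lift of `φ`):
`g` is an orientation-preserving circle homeomorphism and there are partitions of the
circle into `φ`-dyadic intervals `I k`, `J k` such that `g` maps `I k` onto `J k` and
`g = φ_{J k}⁻¹ ∘ φ_{I k}` on `I k`, i.e. `φ^[m k] ∘ g = φ^[n k]` on `I k`. -/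
def InThompsonGroup (φ : UnitAddCircle → UnitAddCircle) (F : ℝ → ℝ)
    (g : UnitAddCircle → UnitAddCircle) : Prop :=
  (∃ G : ℝ → ℝ, IsOPLift g G) ∧
  ∃ (r : ℕ) (I J : Fin r → Set UnitAddCircle) (n m : Fin r → ℕ),
    0 < r ∧
    (∀ k, IsDyadic F (n k) (I k)) ∧ (∀ k, IsDyadic F (m k) (J k)) ∧
    (⋃ k, I k) = Set.univ ∧ (⋃ k, J k) = Set.univ ∧
    (Pairwise fun k l => interior (I k) ∩ interior (I l) = ∅) ∧
    (Pairwise fun k l => interior (J k) ∩ interior (J l) = ∅) ∧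
    (∀ k, g '' I k = J k) ∧ (∀ k, ∀ x ∈ I k, φ^[m k] (g x) = φ^[n k] x)

/-- `x` is a nonexpandable point for the action of `T_φ`: `g′(x) ≤ 1` for every
`g ∈ T_φ` (derivatives are computed via lifts). -/
def NonExpandable (φ : UnitAddCircle → UnitAddCircle) (F : ℝ → ℝ)
    (x : UnitAddCircle) : Prop :=
  ∀ g G, InThompsonGroup φ F g → IsOPLift g G →
    ∀ x' : ℝ, (x' : UnitAddCircle) = x → deriv G x' ≤ 1

/-- `I` is nice for `φ`: no forward iterate of the boundary returns to the interior. -/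
def IsNice (φ : UnitAddCircle → UnitAddCircle) (I : Set UnitAddCircle) : Prop :=
  ∀ n : ℕ, 1 ≤ n → (φ^[n]) '' (frontier I) ∩ interior I = ∅

/-- A nice interval: a proper nondegenerate closed arc that is nice. -/
def IsNiceInterval (φ : UnitAddCircle → UnitAddCircle) (I : Set UnitAddCircle) : Prop :=
  (∃ a ℓ : ℝ, 0 < ℓ ∧ ℓ < 1 ∧ I = closedArc a ℓ) ∧ IsNice φ I

/-- `J` is a connected component of `S`. -/
def IsComponentOf (J S : Set UnitAddCircle) : Prop :=
  ∃ x ∈ S, J = connectedComponentIn S x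

/-- The set of left endpoints of connected components of `𝕊¹ \ Λ`. -/
def leftEndpoints (Λ : Set UnitAddCircle) : Set UnitAddCircle :=
  {z | ∃ C : Set UnitAddCircle, IsComponentOf C (Set.univ \ Λ) ∧
    ∃ a ℓ : ℝ, 0 < ℓ ∧ ℓ ≤ 1 ∧ C = openArc a ℓ ∧ z = (a : UnitAddCircle)}

/-- The set of right endpoints of connected components of `𝕊¹ \ Λ`. -/
def rightEndpoints (Λ : Set UnitAddCircle) : Set UnitAddCircle :=
  {z | ∃ C : Set UnitAddCircle, IsComponentOf C (Set.univ \ Λ) ∧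
    ∃ a ℓ : ℝ, 0 < ℓ ∧ ℓ ≤ 1 ∧ C = openArc a ℓ ∧ z = ((a + ℓ : ℝ) : UnitAddCircle)}

/-- `x` is a parabolic periodic point of `φ`: `φ^s(x) = x` and `(φ^s)′(x) = 1`
(the derivative computed via the lift `F`). -/
def IsParabolicPeriodicPt (φ : UnitAddCircle → UnitAddCircle) (F : ℝ → ℝ)
    (x : UnitAddCircle) : Prop :=
  ∃ s : ℕ, 1 ≤ s ∧ φ^[s] x = x ∧
    ∀ x' : ℝ, (x' : UnitAddCircle) = x → deriv (F^[s]) x' = 1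

theorem coe_eq_coe_iff_exists_int {x y : ℝ} :
    (x : UnitAddCircle) = y ↔ ∃ m : ℤ, x = y + m := by
  rw [← sub_eq_zero, ← AddCircle.coe_sub, AddCircle.coe_eq_zero_iff]
  exact exists_congr fun m => by
    rw [zsmul_one, eq_comm, sub_eq_iff_eq_add']

theorem iterate_add_one_of_degree_two {F : ℝ → ℝ} (h1 : ∀ x, F (x + 1) = F x + 2) (n : ℕ)
    (x : ℝ) : F^[n] (x + 1) = F^[n] x + 2 ^ n := by
  have hnat : ∀ (m : ℕ) (y : ℝ), F (y + m) = F y + 2 * m := fun m y => by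
    induction m with
    | zero => simp
    | succ m ih => push_cast; rw [← add_assoc, h1, ih]; ring
  induction n with
  | zero => simp
  | succ n ih =>
    rw [Function.iterate_succ_apply', ih, Function.iterate_succ_apply', pow_succ']
    exact_mod_cast hnat (2 ^ n) _

theorem map_add_int_of_degree_one {H : ℝ → ℝ} (h1 : ∀ x, H (x + 1) = H x + 1) (x : ℝ) (m : ℤ) :
    H (x + m) = H x + m := by
  have hper : Function.Periodic (fun y => H y - y) 1 := fun y => by simp only [h1]; ring
  have := hper.int_mul m x
  simp only [mul_one] at this
  linarith

theorem semiconj_iterate {F H : ℝ → ℝ} (hHF : ∀ x, H (F x) = 2 * H x) (n : ℕ) (x : ℝ) :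
    H (F^[n] x) = 2 ^ n * H x := by
  induction n with
  | zero => simp
  | succ n ih => rw [Function.iterate_succ_apply', hHF, ih, pow_succ']; ring

/-- An increasing continuous `F : ℝ → ℝ` commuting with the unit translation up to degree two is
semiconjugate to `x ↦ 2 * x` by a continuous monotone map of degree one. -/
theorem exists_semiconj_two_mul {F : ℝ → ℝ} (hc : Continuous F) (hm : Monotone F)
    (h1 : ∀ x, F (x + 1) = F x + 2) :
    ∃ H : ℝ → ℝ, Continuous H ∧ Monotone H ∧ (∀ x, H (x + 1) = H x + 1) ∧
      ∀ x, H (F x) = 2 * H x := by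
  set g : ℝ → ℝ := fun y => F y - 2 * y with hg
  have hgc : Continuous g := by fun_prop
  have hgp : Function.Periodic g 1 := fun y => by simp only [hg, h1]; ring
  obtain ⟨C, hC⟩ : ∃ C, ∀ y, ‖g y‖ ≤ C := by
    obtain ⟨C, hC⟩ := (isCompact_Icc (a := (0 : ℝ)) (b := 1)).exists_bound_of_continuousOn
      hgc.continuousOn
    refine ⟨C, fun y => ?_⟩
    obtain ⟨z, hz, hyz⟩ := hgp.exists_mem_Ico₀ one_pos y
    exact hyz ▸ hC z ⟨hz.1, hz.2.le⟩
  set u : ℕ → ℝ → ℝ := fun n x => g (F^[n] x) / 2 ^ (n + 1) with hu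
  have hub : ∀ n x, ‖u n x‖ ≤ C / 2 * (1 / 2) ^ n := fun n x => by
    have : C / 2 * (1 / 2) ^ n = C / 2 ^ (n + 1) := by
      rw [pow_succ, one_div, inv_pow]; field_simp
    rw [this, hu, norm_div, norm_pow, Real.norm_ofNat]
    gcongr
    exact hC _
  have hsum : Summable fun n : ℕ => C / 2 * (1 / 2 : ℝ) ^ n :=
    summable_geometric_two.mul_left _
  have hus : ∀ x, Summable fun n => u n x := fun x => hsum.of_norm_bounded fun n => hub n x
  have hpart : ∀ x n, x + ∑ i ∈ Finset.range n, u i x = F^[n] x / 2 ^ n := fun x n => by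
    induction n with
    | zero => simp
    | succ n ih =>
      rw [Finset.sum_range_succ, ← add_assoc, ih, Function.iterate_succ_apply']
      simp only [hu, hg]
      field_simp
      ring
  have hlim : ∀ x, Tendsto (fun n => F^[n] x / 2 ^ n) atTop (𝓝 (x + ∑' n, u n x)) := fun x => by
    simpa only [hpart] using (hus x).hasSum.tendsto_sum_nat.const_add x
  refine ⟨fun x => x + ∑' n, u n x, ?_, ?_, ?_, ?_⟩
  · refine continuous_id.add (continuous_tsum (fun n => ?_) hsum hub)
    exact (hgc.comp (hc.iterate n)).div_const _
  · intro x y hxy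
    refine le_of_tendsto_of_tendsto' (hlim x) (hlim y) fun n => ?_
    have := hm.iterate n hxy
    gcongr
  · intro x
    refine tendsto_nhds_unique (hlim (x + 1)) (((hlim x).add_const 1).congr fun n => ?_)
    rw [iterate_add_one_of_degree_two h1]
    field_simp
  · intro x
    refine tendsto_nhds_unique (hlim (F x))
      ((((tendsto_add_atTop_iff_nat 1).2 (hlim x)).const_mul 2).congr fun n => ?_)
    rw [Function.iterate_succ_apply, pow_succ]
    field_simp

namespace IsLiftDeg2

variable {φ : UnitAddCircle → UnitAddCircle} {F H : ℝ → ℝ}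

theorem iterate_coe (hF : IsLiftDeg2 φ F) (n : ℕ) (x : ℝ) :
    φ^[n] (x : UnitAddCircle) = (F^[n] x : ℝ) := by
  induction n with
  | zero => rfl
  | succ n ih => rw [Function.iterate_succ_apply', ih, hF.2.2.2, Function.iterate_succ_apply']

theorem isPeriodicInterval_closedArc (hF : IsLiftDeg2 φ F) {s : ℕ} (hs : 1 ≤ s) {a ℓ : ℝ}
    (hℓ : 0 < ℓ) (hℓ1 : ℓ < 1) {k : ℤ} (ha : F^[s] a = a + k)
    (hb : F^[s] (a + ℓ) = a + ℓ + k) : IsPeriodicInterval φ s (closedArc a ℓ) := by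
  have hmono := hF.2.1.iterate s
  have hmem : ∀ t ∈ Icc a (a + ℓ), F^[s] t ∈ Icc (a + k) (a + ℓ + k) := fun t ht =>
    ⟨ha ▸ hmono.monotone ht.1, hb ▸ hmono.monotone ht.2⟩
  refine ⟨hs, ⟨a, ℓ, hℓ, hℓ1, rfl⟩, ?_, ?_, ?_⟩
  · rintro _ ⟨t, ht, rfl⟩
    have := hmem t ht
    refine ⟨F^[s] t - k, ⟨by linarith [this.1], by linarith [this.2]⟩, ?_⟩
    simp only [hF.iterate_coe]
    exact coe_eq_coe_iff_exists_int.2 ⟨-k, by push_cast; ring⟩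
  · rintro _ ⟨t, ht, rfl⟩ _ ⟨t', ht', rfl⟩ h
    simp only [hF.iterate_coe] at h
    obtain ⟨m, hm⟩ := coe_eq_coe_iff_exists_int.1 h
    have h1 := hmem t ht
    have h2 := hmem t' ht'
    have hm0 : m = 0 := by
      have h3 : (m : ℝ) < 1 := by linarith [h1.2, h2.1]
      have h4 : (-1 : ℝ) < m := by linarith [h1.1, h2.2]
      have h5 : m < 1 := by exact_mod_cast h3
      have h6 : -1 < m := by exact_mod_cast h4
      omega
    have : t = t' := hmono.injective (by rw [hm, hm0]; simp)
    rw [this]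
  · rintro _ ⟨y, hy, rfl⟩
    obtain ⟨t, ht, hty⟩ := intermediate_value_Icc (by linarith : a ≤ a + ℓ)
      (hF.1.iterate s).continuousOn
      (show y + k ∈ Icc (F^[s] a) (F^[s] (a + ℓ)) by
        rw [ha, hb]; exact ⟨by linarith [hy.1], by linarith [hy.2]⟩)
    refine ⟨t, ⟨t, ht, rfl⟩, ?_⟩
    simp only [hF.iterate_coe, hty]
    exact coe_eq_coe_iff_exists_int.2 ⟨k, rfl⟩

/-- A semiconjugacy to doubling is constant on the lift of a periodic interval. -/
theorem semiconj_eq_of_isPeriodicInterval (hF : IsLiftDeg2 φ F) (hHm : Monotone H)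
    (hH1 : ∀ x, H (x + 1) = H x + 1) (hHF : ∀ x, H (F x) = 2 * H x) {s : ℕ} {a ℓ : ℝ}
    (hℓ1 : ℓ < 1) (hI : IsPeriodicInterval φ s (closedArc a ℓ)) {t : ℝ}
    (ht : t ∈ Icc a (a + ℓ)) : H t = H a := by
  have key : ∀ n : ℕ, (2 : ℝ) ^ n * (H t - H a) ≤ 1 := by
    intro n
    have hinj : InjOn (φ^[s * n]) (closedArc a ℓ) := by
      rw [Function.iterate_mul]
      exact (hI.2.2.iterate n).injOn
    have hle : F^[s * n] t ≤ F^[s * n] a + 1 := by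
      by_contra! hlt
      obtain ⟨c, hc, hca⟩ := intermediate_value_Icc ht.1 (hF.1.iterate (s * n)).continuousOn
        (show F^[s * n] a + 1 ∈ Icc (F^[s * n] a) (F^[s * n] t) from ⟨by linarith, hlt.le⟩)
      have hca' : (c : UnitAddCircle) = a := by
        refine hinj ⟨c, ⟨hc.1, hc.2.trans ht.2⟩, rfl⟩
          ⟨a, ⟨le_rfl, ht.1.trans ht.2⟩, rfl⟩ ?_
        rw [hF.iterate_coe, hF.iterate_coe, hca]
        exact coe_eq_coe_iff_exists_int.2 ⟨1, by simp⟩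
      obtain ⟨m, hm⟩ := coe_eq_coe_iff_exists_int.1 hca'
      have h1 : (m : ℝ) < 1 := by linarith [hc.2, ht.2]
      have h2 : (-1 : ℝ) < m := by linarith [hc.1]
      have h3 : m < 1 := by exact_mod_cast h1
      have h4 : -1 < m := by exact_mod_cast h2
      have h5 : m = 0 := by omega
      rw [hm, h5] at hca
      simp at hca
    have h2 := hHm hle
    rw [hH1, semiconj_iterate hHF, semiconj_iterate hHF] at h2
    have h3 : (2 : ℝ) ^ n ≤ 2 ^ (s * n) :=
      pow_le_pow_right₀ one_le_two (Nat.le_mul_of_pos_left n hI.1)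
    nlinarith [hHm ht.1]
  refine le_antisymm ?_ (hHm ht.1)
  by_contra! hlt
  obtain ⟨n, hn⟩ := pow_unbounded_of_one_lt (1 / (H t - H a)) (one_lt_two (α := ℝ))
  rw [div_lt_iff₀ (by linarith)] at hn
  linarith [key n]

/-- A semiconjugacy to doubling takes rational values on periodic intervals. -/
theorem semiconj_mem_range_ratCast (hF : IsLiftDeg2 φ F) (hHm : Monotone H)
    (hH1 : ∀ x, H (x + 1) = H x + 1) (hHF : ∀ x, H (F x) = 2 * H x) {s : ℕ}
    {I : Set UnitAddCircle} (hI : IsPeriodicInterval φ s I) {y : ℝ}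
    (hy : (y : UnitAddCircle) ∈ I) : ∃ q : ℚ, (q : ℝ) = H y := by
  obtain ⟨a, ℓ, hℓ, hℓ1, rfl⟩ := hI.2.1
  have hconst := fun t ht => hF.semiconj_eq_of_isPeriodicInterval hHm hH1 hHF hℓ1 hI (t := t) ht
  obtain ⟨t, ht, hty⟩ := hy
  obtain ⟨m, hm⟩ := coe_eq_coe_iff_exists_int.1 hty
  have hya : H y = H a - m := by
    rw [← hconst t ht, hm, map_add_int_of_degree_one hH1]; ring
  obtain ⟨t', ht', hta⟩ := hI.2.2.mapsTo ⟨a, ⟨le_rfl, by linarith⟩, rfl⟩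
  rw [hF.iterate_coe] at hta
  obtain ⟨k, hk⟩ := coe_eq_coe_iff_exists_int.1 hta
  have h2 : H a = 2 ^ s * H a + k := by
    have h3 := hconst t' ht'
    rwa [hk, map_add_int_of_degree_one hH1, semiconj_iterate hHF, eq_comm] at h3
  have hs : (1 : ℝ) < 2 ^ s := one_lt_pow₀ one_lt_two (by have := hI.1; omega)
  refine ⟨-k / (2 ^ s - 1) - m, ?_⟩
  push_cast
  have : (2 : ℝ) ^ s - 1 ≠ 0 := by linarith
  rw [hya]
  field_simp
  linarith

/-- A semiconjugacy to doubling is constant across any interval whose interior avoids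
`lambdaSet φ`. -/
theorem semiconj_eq_of_forall_notMem_lambdaSet (hF : IsLiftDeg2 φ F) (hHc : Continuous H)
    (hHm : Monotone H) (hH1 : ∀ x, H (x + 1) = H x + 1) (hHF : ∀ x, H (F x) = 2 * H x)
    {p q : ℝ} (hpq : p ≤ q) (h : ∀ t ∈ Ioo p q, (t : UnitAddCircle) ∉ lambdaSet φ) :
    H p = H q := by
  refine le_antisymm (hHm hpq) ?_
  by_contra! hlt
  obtain ⟨r, hr, hpr, hrq⟩ := exists_irrational_btwn hlt
  obtain ⟨t, ht, rfl⟩ := intermediate_value_Ioo hpq hHc.continuousOn ⟨hpr, hrq⟩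
  have htΛ := h t ht
  simp only [lambdaSet, Set.mem_sdiff, mem_univ, true_and, not_not, mem_iUnion, mem_preimage,
    mem_ofPred_eq] at htΛ
  obtain ⟨n, I, ⟨⟨s, hI⟩, -⟩, hn⟩ := htΛ
  rw [hF.iterate_coe] at hn
  obtain ⟨c, hc⟩ := hF.semiconj_mem_range_ratCast hHm hH1 hHF hI hn
  rw [semiconj_iterate hHF] at hc
  refine hr ⟨c / 2 ^ n, ?_⟩
  push_cast
  rw [hc]
  field_simp

end IsLiftDeg2

/-- Lemma 2.2(a): if a one-sided neighborhood of a periodic point `x`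
misses `Λ`, then `x` is the corresponding endpoint of a periodic interval of period `s`. -/
theorem periodic_point_isolated_endpoint_of_periodic_interval
    (φ : UnitAddCircle → UnitAddCircle) (F : ℝ → ℝ)
    (hF : IsLiftDeg2 φ F)
    (hnc : ¬ ConjugateToDoubling φ)
    (hfin : {I | IsMaxPeriodicInterval φ I}.Finite)
    (hne : {I | IsMaxPeriodicInterval φ I}.Nonempty)
    (x : UnitAddCircle) (s : ℕ) (hs : 1 ≤ s) (hper : φ^[s] x = x) :
    ((∃ ε : ℝ, 0 < ε ∧ rightArc x ε ∩ lambdaSet φ = ∅) →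
      ∃ a ℓ : ℝ, 0 < ℓ ∧ ℓ < 1 ∧ x = (a : UnitAddCircle) ∧
        IsPeriodicInterval φ s (closedArc a ℓ)) ∧
    ((∃ ε : ℝ, 0 < ε ∧ leftArc x ε ∩ lambdaSet φ = ∅) →
      ∃ a ℓ : ℝ, 0 < ℓ ∧ ℓ < 1 ∧ x = ((a + ℓ : ℝ) : UnitAddCircle) ∧
        IsPeriodicInterval φ s (closedArc a ℓ)) := by
  obtain ⟨H, hHc, hHm, hH1, hHF⟩ := exists_semiconj_two_mul hF.1 hF.2.1.monotone hF.2.2.1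
  obtain ⟨p, rfl⟩ := QuotientAddGroup.mk_surjective x
  change φ^[s] (p : UnitAddCircle) = p at hper
  rw [hF.iterate_coe] at hper
  obtain ⟨k, hk⟩ := coe_eq_coe_iff_exists_int.1 hper
  have hmono := hF.2.1.iterate s
  have hcont := hF.1.iterate s
  have hpow : (1 : ℝ) ≤ 2 ^ s := one_le_pow₀ one_le_two
  have hHp : 2 ^ s * H p = H p + k := by
    rw [← semiconj_iterate hHF, hk, map_add_int_of_degree_one hH1]
  have hfib : ∀ t, H (F^[s] t - k) = H p ↔ H t = H p := fun t => by
    have h1 := map_add_int_of_degree_one hH1 (F^[s] t - k) k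
    rw [sub_add_cancel, semiconj_iterate hHF] at h1
    rw [← mul_right_inj' (by positivity : (2 : ℝ) ^ s ≠ 0) (b := H t), hHp, h1, add_left_inj]
  have hclosed : IsClosed {t | H t = H p} := isClosed_eq hHc continuous_const
  have hne' : {t | H t = H p}.Nonempty := ⟨p, rfl⟩
  have hlt : ∀ t ∈ {t | H t = H p}, t < p + 1 := fun t ht => by
    by_contra! h
    have := hHm h
    rw [hH1, ht] at this
    linarith
  have hgt : ∀ t ∈ {t | H t = H p}, p - 1 < t := fun t ht => by
    by_contra! h
    have := hHm h
    have h1 := hH1 (p - 1)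
    rw [sub_add_cancel] at h1
    rw [ht] at this
    linarith
  refine ⟨?_, ?_⟩
  · rintro ⟨ε, hε, hΛ⟩
    have hq : H p = H (p + ε) := by
      refine hF.semiconj_eq_of_forall_notMem_lambdaSet hHc hHm hH1 hHF (by linarith)
        fun t ht htΛ => ?_
      refine (hΛ.subset ⟨⟨t - p, by linarith [ht.1], by linarith [ht.2], ?_⟩, htΛ⟩ :)
      change (t : UnitAddCircle) = (p : UnitAddCircle) + ((t - p : ℝ) : UnitAddCircle)
      rw [← AddCircle.coe_add, add_sub_cancel]
    have hbdd : BddAbove {t | H t = H p} := ⟨p + 1, fun t ht => (hlt t ht).le⟩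
    have hb := hclosed.csSup_mem hne' hbdd
    have hmax : ∀ t, H t = H p → t ≤ sSup {t | H t = H p} := fun t ht => le_csSup hbdd ht
    set b := sSup {t | H t = H p}
    have hpb : p + ε ≤ b := hmax _ hq.symm
    have hb1 := hlt b hb
    have hfix : F^[s] b = b + k := by
      refine le_antisymm (by linarith [hmax _ ((hfib b).2 hb)]) ?_
      obtain ⟨c, -, hc⟩ := intermediate_value_Icc (by linarith : p ≤ p + 1) hcont.continuousOn
        (show b + k ∈ Icc (F^[s] p) (F^[s] (p + 1)) by
          rw [iterate_add_one_of_degree_two hF.2.2.1, hk]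
          constructor <;> linarith)
      rw [← hc]
      refine hmono.monotone (hmax c ((hfib c).1 ?_))
      rw [hc, add_sub_cancel_right]
      exact hb
    exact ⟨p, b - p, by linarith, by linarith, rfl,
      hF.isPeriodicInterval_closedArc hs (by linarith) (by linarith) hk
        (by rw [add_sub_cancel, hfix])⟩
  · rintro ⟨ε, hε, hΛ⟩
    have hq : H (p - ε) = H p := by
      refine hF.semiconj_eq_of_forall_notMem_lambdaSet hHc hHm hH1 hHF (by linarith)
        fun t ht htΛ => ?_
      refine (hΛ.subset ⟨⟨p - t, by linarith [ht.2], by linarith [ht.1], ?_⟩, htΛ⟩ :)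
      change (t : UnitAddCircle) = (p : UnitAddCircle) - ((p - t : ℝ) : UnitAddCircle)
      rw [← AddCircle.coe_sub, sub_sub_cancel]
    have hbdd : BddBelow {t | H t = H p} := ⟨p - 1, fun t ht => (hgt t ht).le⟩
    have hb := hclosed.csInf_mem hne' hbdd
    have hmin : ∀ t, H t = H p → sInf {t | H t = H p} ≤ t := fun t ht => csInf_le hbdd ht
    set b := sInf {t | H t = H p}
    have hpb : b ≤ p - ε := hmin _ hq
    have hb1 := hgt b hb
    have hfix : F^[s] b = b + k := by
      refine le_antisymm ?_ (by linarith [hmin _ ((hfib b).2 hb)])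
      have h1 := iterate_add_one_of_degree_two hF.2.2.1 s (p - 1)
      rw [sub_add_cancel, hk] at h1
      obtain ⟨c, -, hc⟩ := intermediate_value_Icc (by linarith : p - 1 ≤ p) hcont.continuousOn
        (show b + k ∈ Icc (F^[s] (p - 1)) (F^[s] p) by
          rw [hk]
          constructor <;> linarith)
      rw [← hc]
      refine hmono.monotone (hmin c ((hfib c).1 ?_))
      rw [hc, add_sub_cancel_right]
      exact hb
    exact ⟨b, p - b, by linarith, by linarith, by rw [add_sub_cancel],
      hF.isPeriodicInterval_closedArc hs (by linarith) (by linarith) hfix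
        (by rw [add_sub_cancel, hk])⟩
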